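/- (Z_2 symmetry of the sl(3) Selberg evaluation.) Let k1, k2 ≥ 0 be integers and let α1, α2, β1, β2, γ be complex numbers with β1 + β2 = γ + 1. Define R(k1, k2, α1, α2, β1, β2, γ) := ∏_{i=0}^{k1−1} [Γ(α1+iγ) Γ(β1+(i−k2)γ) Γ((i+1)γ)] / [Γ(α1+β1+(i+k1−k2−1)γ) Γ(γ)] · ∏_{i=0}^{k2−1} [Γ(α2+iγ) Γ(β2+iγ) Γ((i+1)γ)] / [Γ(α2+β2+(i+k2−k1−1)γ) Γ(γ)] · ∏_{i=0}^{k1−1} Γ(α1+α2+(i−1)γ) / Γ(α1+α2+(i+k2−1)γ). Assume that none of the Gamma-function arguments occurring in R(k1, k2, α1, α2, β1, β2, γ), in R(k2, k1, α2, α1, β2, β1, γ), or in the products below is a nonpositive integer. Then R(k2, k1, α2, α1, β2, β1, γ) = R(k1, k2, α1, α2, β1, β2, γ) · ∏_{i=0}^{k1−1} Γ(β1+iγ) / Γ(β1+(i−k2)γ) · ∏_{i=0}^{k2−1} Γ(β2+(i−k1)γ) / Γ(β2+iγ). -/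

import Mathlib

/-- The right-hand side of the sl(3) Selberg evaluation. -/
noncomputable def sl3SelbergRHS (k1 k2 : ℕ) (α1 α2 β1 β2 γ : ℂ) : ℂ :=
  (∏ i ∈ Finset.range k1,
      (Complex.Gamma (α1 + (i : ℂ) * γ) * Complex.Gamma (β1 + ((i : ℂ) - (k2 : ℂ)) * γ) *
        Complex.Gamma (((i : ℂ) + 1) * γ)) /
      (Complex.Gamma (α1 + β1 + ((i : ℂ) + (k1 : ℂ) - (k2 : ℂ) - 1) * γ) *
        Complex.Gamma γ)) *
  (∏ i ∈ Finset.range k2,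
      (Complex.Gamma (α2 + (i : ℂ) * γ) * Complex.Gamma (β2 + (i : ℂ) * γ) *
        Complex.Gamma (((i : ℂ) + 1) * γ)) /
      (Complex.Gamma (α2 + β2 + ((i : ℂ) + (k2 : ℂ) - (k1 : ℂ) - 1) * γ) *
        Complex.Gamma γ)) *
  ∏ i ∈ Finset.range k1,
      Complex.Gamma (α1 + α2 + ((i : ℂ) - 1) * γ) /
        Complex.Gamma (α1 + α2 + ((i : ℂ) + (k2 : ℂ) - 1) * γ)

/-- `z` is not a nonpositive integer (so `Γ(z)` avoids all poles). -/
def NotNonposInt (z : ℂ) : Prop := ∀ m : ℤ, m ≤ 0 → z ≠ (m : ℂ)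

theorem NotNonposInt.Gamma_ne_zero {z : ℂ} (h : NotNonposInt z) : Complex.Gamma z ≠ 0 :=
  Complex.Gamma_ne_zero fun m => by
    simpa using h (-(m : ℤ)) (by omega)

/-- The product of shifted quotients `f i / f (m + i)` over `i < n` is symmetric in `m` and `n`. -/
theorem prod_range_div_shift_comm {K : Type*} [Field K] (f : ℕ → K) (m n : ℕ)
    (hm : ∀ i < n, f (m + i) ≠ 0) (hn : ∀ i < m, f (n + i) ≠ 0) :
    ∏ i ∈ Finset.range n, f i / f (m + i) = ∏ i ∈ Finset.range m, f i / f (n + i) := by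
  rw [Finset.prod_div_distrib, Finset.prod_div_distrib, div_eq_div_iff,
    ← Finset.prod_range_add, ← Finset.prod_range_add, add_comm]
  · exact Finset.prod_ne_zero_iff.mpr fun i hi => hm i (Finset.mem_range.mp hi)
  · exact Finset.prod_ne_zero_iff.mpr fun i hi => hn i (Finset.mem_range.mp hi)

/-- Z₂ symmetry of the sl(3) Selberg evaluation. Assume `β1 + β2 = γ + 1`
and that none of the Gamma arguments occurring below is a nonpositive integer. Then
`R(k2,k1,α2,α1,β2,β1,γ) = R(k1,k2,α1,α2,β1,β2,γ) · ∏_{i=0}^{k1−1} Γ(β1+iγ)/Γ(β1+(i−k2)γ)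
 · ∏_{i=0}^{k2−1} Γ(β2+(i−k1)γ)/Γ(β2+iγ)`. -/
theorem sl3_rhs_Z2_symmetry (k1 k2 : ℕ) (α1 α2 β1 β2 γ : ℂ)
    (hββ : β1 + β2 = γ + 1)
    (hγ : NotNonposInt γ)
    (h1 : ∀ i : ℕ, i < k1 →
      NotNonposInt (α1 + (i : ℂ) * γ) ∧
      NotNonposInt (β1 + (i : ℂ) * γ) ∧
      NotNonposInt (β1 + ((i : ℂ) - (k2 : ℂ)) * γ) ∧
      NotNonposInt (((i : ℂ) + 1) * γ) ∧
      NotNonposInt (α1 + β1 + ((i : ℂ) + (k1 : ℂ) - (k2 : ℂ) - 1) * γ) ∧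
      NotNonposInt (α1 + α2 + ((i : ℂ) - 1) * γ) ∧
      NotNonposInt (α1 + α2 + ((i : ℂ) + (k2 : ℂ) - 1) * γ))
    (h2 : ∀ i : ℕ, i < k2 →
      NotNonposInt (α2 + (i : ℂ) * γ) ∧
      NotNonposInt (β2 + (i : ℂ) * γ) ∧
      NotNonposInt (β2 + ((i : ℂ) - (k1 : ℂ)) * γ) ∧
      NotNonposInt (((i : ℂ) + 1) * γ) ∧
      NotNonposInt (α2 + β2 + ((i : ℂ) + (k2 : ℂ) - (k1 : ℂ) - 1) * γ) ∧
      NotNonposInt (α2 + α1 + ((i : ℂ) - 1) * γ) ∧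
      NotNonposInt (α2 + α1 + ((i : ℂ) + (k1 : ℂ) - 1) * γ)) :
    sl3SelbergRHS k2 k1 α2 α1 β2 β1 γ
      = sl3SelbergRHS k1 k2 α1 α2 β1 β2 γ *
        (∏ i ∈ Finset.range k1,
          Complex.Gamma (β1 + (i : ℂ) * γ) /
            Complex.Gamma (β1 + ((i : ℂ) - (k2 : ℂ)) * γ)) *
        ∏ i ∈ Finset.range k2,
          Complex.Gamma (β2 + ((i : ℂ) - (k1 : ℂ)) * γ) /
            Complex.Gamma (β2 + (i : ℂ) * γ) := by
  have hA : ∏ i ∈ Finset.range k2, Complex.Gamma (α2 + α1 + ((i : ℂ) - 1) * γ) /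
        Complex.Gamma (α2 + α1 + ((i : ℂ) + (k1 : ℂ) - 1) * γ) =
      ∏ i ∈ Finset.range k1, Complex.Gamma (α1 + α2 + ((i : ℂ) - 1) * γ) /
        Complex.Gamma (α1 + α2 + ((i : ℂ) + (k2 : ℂ) - 1) * γ) := by
    have key := prod_range_div_shift_comm
      (fun i : ℕ => Complex.Gamma (α1 + α2 + ((i : ℂ) - 1) * γ)) k1 k2
      (fun i hi => by
        obtain ⟨-, -, -, -, -, -, h⟩ := h2 i hi
        simpa [add_comm] using h.Gamma_ne_zero)
      (fun i hi => by
        obtain ⟨-, -, -, -, -, -, h⟩ := h1 i hi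
        simpa [add_comm] using h.Gamma_ne_zero)
    simpa only [Nat.cast_add, add_comm] using key
  unfold sl3SelbergRHS
  rw [hA, mul_right_comm _ _ (∏ i ∈ Finset.range k1, Complex.Gamma (β1 + (i : ℂ) * γ) / _),
    mul_right_comm _ _ (∏ i ∈ Finset.range k2, _ / Complex.Gamma (β2 + (i : ℂ) * γ))]
  congr 1
  rw [mul_assoc, mul_mul_mul_comm, ← Finset.prod_mul_distrib, ← Finset.prod_mul_distrib, mul_comm]
  congr 1 <;> refine Finset.prod_congr rfl fun i hi => ?_
  · obtain ⟨-, -, h, -⟩ := h1 i (Finset.mem_range.mp hi)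
    have := h.Gamma_ne_zero
    rw [mul_comm _ γ] at this
    field_simp
  · obtain ⟨-, h, -⟩ := h2 i (Finset.mem_range.mp hi)
    have := h.Gamma_ne_zero
    field_simp
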